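/- arXiv:1409.4914 — 5 statements merged into one kernel-verified Lean document; each statement's English description precedes it below -/
import Mathlib

section
/- Let γ : ℝ → Matrix (Fin 2) (Fin 2) ℝ and Ω : ℝ → ℝ be differentiable at t, with γ(t) invertible and Ω(t) ≠ 0, and set γ̂(s) = Ω(s)^2 • γ(s). Then Matrix.trace (γ̂(t)⁻¹ * deriv γ̂ t) = Matrix.trace (γ(t)⁻¹ * deriv γ t) + 2 * (deriv (fun s => Ω s ^ 2) t) / Ω(t)^2; equivalently, the γ̂-trace of the derivative of γ̂ equals the γ-trace of the derivative of γ plus twice the logarithmic derivative of Ω². -/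
open Matrix

attribute [local instance] Matrix.normedAddCommGroup Matrix.normedSpace

/-- Conformal trace identity: for a curve of invertible `2×2` matrices `γ` and a
nonvanishing scalar `Ω`, with `γ̂ = Ω² • γ`, one has
`tr(γ̂⁻¹ γ̂') = tr(γ⁻¹ γ') + 2 (Ω²)' / Ω²`. -/
theorem conformal_trace_identity
    (γ : ℝ → Matrix (Fin 2) (Fin 2) ℝ) (Ω : ℝ → ℝ) (t : ℝ)
    (hγ : DifferentiableAt ℝ γ t) (hΩ : DifferentiableAt ℝ Ω t)
    (hinv : IsUnit (γ t).det) (hΩ0 : Ω t ≠ 0)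
    (γhat : ℝ → Matrix (Fin 2) (Fin 2) ℝ)
    (hdef : ∀ s, γhat s = Ω s ^ 2 • γ s) :
    Matrix.trace ((γhat t)⁻¹ * deriv γhat t) =
      Matrix.trace ((γ t)⁻¹ * deriv γ t) +
        2 * deriv (fun s => Ω s ^ 2) t / Ω t ^ 2 := by
  have hfun : γhat = fun s => Ω s ^ 2 • γ s := funext hdef
  have hΩ2 : HasDerivAt (fun s => Ω s ^ 2) (deriv (fun s => Ω s ^ 2) t) t :=
    (hΩ.pow 2).hasDerivAt
  have hd : deriv γhat t = Ω t ^ 2 • deriv γ t + deriv (fun s => Ω s ^ 2) t • γ t := by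
    rw [hfun]
    exact (hΩ2.smul hγ.hasDerivAt).deriv
  have h2 : Ω t ^ 2 ≠ 0 := pow_ne_zero 2 hΩ0
  have hi : (γhat t)⁻¹ = (Ω t ^ 2)⁻¹ • (γ t)⁻¹ := by
    apply Matrix.inv_eq_left_inv
    rw [hdef, Matrix.smul_mul, Matrix.mul_smul, smul_smul, inv_mul_cancel₀ h2, one_smul,
      Matrix.nonsing_inv_mul _ hinv]
  rw [hd, hi]
  generalize deriv (fun s => Ω s ^ 2) t = c
  rw [Matrix.mul_add, Matrix.smul_mul, Matrix.smul_mul, Matrix.mul_smul, Matrix.mul_smul,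
    smul_smul, inv_mul_cancel₀ h2, one_smul, Matrix.nonsing_inv_mul _ hinv, Matrix.trace_add,
    Matrix.trace_smul, Matrix.trace_smul, Matrix.trace_one]
  simp only [smul_eq_mul, Fintype.card_fin, Nat.cast_ofNat]
  ring
end

section
/- Let A : ℝ × ℝ → Matrix (Fin 2) (Fin 2) ℝ be twice continuously differentiable with A(x) invertible for every x. Then the mixed-derivative integrability condition holds: for every x, ∂_1 (fun y => Matrix.trace (A(y)⁻¹ * ∂_2 A(y))) x = ∂_2 (fun y => Matrix.trace (A(y)⁻¹ * ∂_1 A(y))) x. -/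
open Matrix

attribute [local instance] Matrix.normedAddCommGroup Matrix.normedSpace

theorem entry_hasFDerivAt (A : ℝ × ℝ → Matrix (Fin 2) (Fin 2) ℝ) (y : ℝ × ℝ)
    (h : DifferentiableAt ℝ A y) (i j : Fin 2) :
    ∃ L : ℝ × ℝ →L[ℝ] ℝ, HasFDerivAt (fun y => A y i j) L y ∧
      ∀ v, L v = (fderiv ℝ A y v) i j := by
  have h1 := h.hasFDerivAt
  have h2 := (hasFDerivAt_pi'.1 h1) i
  have h3 := (hasFDerivAt_pi'.1 h2) j
  exact ⟨_, h3, fun v => rfl⟩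

theorem logdet_fderiv (A : ℝ × ℝ → Matrix (Fin 2) (Fin 2) ℝ) (hA : ContDiff ℝ 2 A)
    (hinv : ∀ x, IsUnit (A x).det) (y v : ℝ × ℝ) :
    fderiv ℝ (fun y => Real.log (A y 0 0 * A y 1 1 - A y 0 1 * A y 1 0)) y v =
      Matrix.trace ((A y)⁻¹ * fderiv ℝ A y v) := by
  have hd : DifferentiableAt ℝ A y := (hA.differentiable (by norm_num)) y
  obtain ⟨La, ha, ea⟩ := entry_hasFDerivAt A y hd 0 0
  obtain ⟨Lb, hb, eb⟩ := entry_hasFDerivAt A y hd 0 1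
  obtain ⟨Lc, hc, ec⟩ := entry_hasFDerivAt A y hd 1 0
  obtain ⟨Ld, hd', ed⟩ := entry_hasFDerivAt A y hd 1 1
  have hne : A y 0 0 * A y 1 1 - A y 0 1 * A y 1 0 ≠ 0 := by
    have := (hinv y).ne_zero
    rwa [Matrix.det_fin_two] at this
  have H := ((ha.mul hd').sub (hb.mul hc)).log hne
  have H' := H.fderiv
  refine (congrArg (fun L : ℝ × ℝ →L[ℝ] ℝ => L v) H').trans ?_
  simp only [Matrix.inv_def, Matrix.adjugate_fin_two, Matrix.trace_fin_two, Matrix.mul_apply,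
    Fin.sum_univ_two, Matrix.det_fin_two, Ring.inverse_eq_inv']
  simp [ea, eb, ec, ed]
  ring

/-- Integrability condition for the conformal factor: for a `C²` two-parameter family
of invertible `2×2` matrices `A`, the mixed derivatives of the logarithmic trace
agree: `∂_1 tr(A⁻¹ ∂_2 A) = ∂_2 tr(A⁻¹ ∂_1 A)`. -/
theorem mixed_derivative_integrability
    (A : ℝ × ℝ → Matrix (Fin 2) (Fin 2) ℝ) (hA : ContDiff ℝ 2 A)
    (hinv : ∀ x, IsUnit (A x).det) :
    ∀ x : ℝ × ℝ,
      fderiv ℝ (fun y => Matrix.trace ((A y)⁻¹ * fderiv ℝ A y (0, 1))) x (1, 0) =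
      fderiv ℝ (fun y => Matrix.trace ((A y)⁻¹ * fderiv ℝ A y (1, 0))) x (0, 1) := by
  intro x
  simp only [← logdet_fderiv A hA hinv]
  have he : ∀ i j, ContDiff ℝ 2 (fun y => A y i j) := fun i j =>
    contDiff_pi.1 (contDiff_pi.1 hA i) j
  have hf : ContDiff ℝ 2 (fun y => Real.log (A y 0 0 * A y 1 1 - A y 0 1 * A y 1 0)) := by
    refine ContDiff.log (((he 0 0).mul (he 1 1)).sub ((he 0 1).mul (he 1 0))) fun y => ?_
    have := (hinv y).ne_zero
    rwa [Matrix.det_fin_two] at this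
  generalize (fun y => Real.log (A y 0 0 * A y 1 1 - A y 0 1 * A y 1 0)) = f at hf ⊢
  have hs : IsSymmSndFDerivAt ℝ f x := hf.contDiffAt.isSymmSndFDerivAt (by simp)
  have hdd : DifferentiableAt ℝ (fderiv ℝ f) x :=
    ((hf.fderiv_right (m := 1) (by norm_num)).differentiable (by norm_num)) x
  have key : ∀ v w : ℝ × ℝ, fderiv ℝ (fun y => fderiv ℝ f y v) x w
      = fderiv ℝ (fderiv ℝ f) x w v := by
    intro v w
    rw [fderiv_clm_apply hdd (differentiableAt_const v)]
    simp
  rw [key, key]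
  exact hs _ _
end

section
/- Let γ̂ be a symmetric positive definite 2×2 real matrix, N̂ : ℝ with N̂ ≠ 0, and N̂¹, N̂² : ℝ. Define the 3×3 real block matrices A⁽ρ⁾ = [[N̂⁻² • γ̂, 0], [0, 2]] (upper-left 2×2 block N̂⁻²γ̂, bottom-right entry 2, off-diagonal blocks zero) and, for each K ∈ {1,2}, A⁽ᴷ⁾ = [[−(N̂ᴷ/N̂²) • γ̂, −e_K], [−e_Kᵀ, −2 N̂ᴷ]], where e_K ∈ ℝ² is the K-th standard basis vector. Then A⁽ρ⁾, A⁽¹⁾ and A⁽²⁾ are all symmetric matrices, and A⁽ρ⁾ is positive definite. -/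
open Matrix

/-- The coefficient matrix `A⁽ρ⁾ = [[N̂⁻² γ̂, 0], [0, 2]]` of the `∂_ρ`-derivative in the
first-order form of the momentum constraint. -/
noncomputable def momCoeffRho (γ : Matrix (Fin 2) (Fin 2) ℝ) (Nh : ℝ) :
    Matrix (Fin 2 ⊕ Fin 1) (Fin 2 ⊕ Fin 1) ℝ :=
  Matrix.fromBlocks ((Nh ^ 2)⁻¹ • γ) 0 0 (2 : Matrix (Fin 1) (Fin 1) ℝ)

/-- The coefficient matrix `A⁽ᴷ⁾ = [[−(N̂ᴷ/N̂²) γ̂, −e_K], [−e_Kᵀ, −2N̂ᴷ]]` of the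
`∂_K`-derivative in the first-order form of the momentum constraint. -/
noncomputable def momCoeffK (γ : Matrix (Fin 2) (Fin 2) ℝ) (Nh : ℝ)
    (NA : Fin 2 → ℝ) (K : Fin 2) :
    Matrix (Fin 2 ⊕ Fin 1) (Fin 2 ⊕ Fin 1) ℝ :=
  Matrix.fromBlocks (-(NA K / Nh ^ 2) • γ)
    (Matrix.of fun i (_ : Fin 1) => -((Pi.single K 1 : Fin 2 → ℝ) i))
    (Matrix.of fun (_ : Fin 1) j => -((Pi.single K 1 : Fin 2 → ℝ) j))
    (Matrix.of fun _ _ => -(2 * NA K))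

/-- The coefficient matrices of the first-order form of the `1+3` momentum constraint
are all symmetric, and the coefficient of `∂_ρ` is positive definite: the momentum
constraint is a first-order symmetric hyperbolic system with `ρ` as time. -/
theorem momentum_constraint_symmetric_hyperbolic
    (γ : Matrix (Fin 2) (Fin 2) ℝ) (hγ : γ.PosDef)
    (Nh : ℝ) (hNh : Nh ≠ 0) (NA : Fin 2 → ℝ) :
    (momCoeffRho γ Nh).IsSymm ∧
    (∀ K : Fin 2, (momCoeffK γ Nh NA K).IsSymm) ∧
    (momCoeffRho γ Nh).PosDef := by
  have hs : γ.IsSymm := by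
    have h := hγ.1
    rwa [Matrix.IsHermitian, Matrix.conjTranspose_eq_transpose_of_trivial] at h
  have hR : (momCoeffRho γ Nh).IsSymm := by
    unfold momCoeffRho
    refine Matrix.IsSymm.fromBlocks (hs.smul _) (by simp) ?_
    ext i j
    fin_cases i
    fin_cases j
    rfl
  refine ⟨hR, ?_, ?_⟩
  · intro K
    unfold momCoeffK
    refine Matrix.IsSymm.fromBlocks (hs.smul _) ?_ ?_
    · ext i j
      rfl
    · ext i j
      rfl
  · refine Matrix.PosDef.of_dotProduct_mulVec_pos ?_ ?_
    · rw [Matrix.IsHermitian, Matrix.conjTranspose_eq_transpose_of_trivial]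
      exact hR
    · intro x hx
      have hc : 0 < (Nh ^ 2)⁻¹ := by positivity
      have h2 : (2 : Matrix (Fin 1) (Fin 1) ℝ) 0 0 = 2 := rfl
      have key : star x ⬝ᵥ (momCoeffRho γ Nh *ᵥ x) =
          (Nh ^ 2)⁻¹ * (star (x ∘ Sum.inl) ⬝ᵥ (γ *ᵥ (x ∘ Sum.inl)))
            + 2 * (x (Sum.inr 0)) ^ 2 := by
        simp [momCoeffRho, dotProduct, Matrix.mulVec, Fin.sum_univ_two, h2]
        ring
      rw [key]
      by_cases h : x ∘ Sum.inl = 0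
      · have hr : x (Sum.inr 0) ≠ 0 := by
          intro h0
          apply hx
          funext i
          rcases i with i | i
          · exact congrFun h i
          · fin_cases i
            exact h0
        rw [h]
        simp only [Matrix.mulVec_zero, dotProduct_zero, mul_zero, zero_add]
        positivity
      · have := mul_pos hc (hγ.dotProduct_mulVec_pos h)
        positivity
end

section
/- Let γ̂ be a symmetric positive definite 2×2 real matrix, N̂ : ℝ with N̂ ≠ 0, and N̂¹, N̂² : ℝ, with the 3×3 matrices A⁽ρ⁾ = [[N̂⁻² • γ̂, 0], [0, 2]] and A⁽ᴷ⁾ = [[−(N̂ᴷ/N̂²) • γ̂, −e_K], [−e_Kᵀ, −2 N̂ᴷ]] for K ∈ {1,2}. For ξ = (ξ_ρ, ξ₁, ξ₂) ∈ ℝ³ set M(ξ) = ξ_ρ • A⁽ρ⁾ + ξ₁ • A⁽¹⁾ + ξ₂ • A⁽²⁾, s = ξ_ρ − N̂¹ξ₁ − N̂²ξ₂ and ξ⃗ = (ξ₁, ξ₂) ∈ ℝ². Then det (M ξ) = (γ̂.det / N̂^4) * s * (2 * s^2 − N̂^2 * (ξ⃗ᵀ * γ̂⁻¹.mulVec ξ⃗));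 consequently det (M ξ) = 0 if and only if n̂·ξ = 0 or (ξ⃗ᵀ γ̂⁻¹ ξ⃗) − 2 (n̂·ξ)² = 0, where n̂·ξ = N̂⁻¹ s. -/
open Matrix

/-- Characteristic polynomial of the momentum constraint system: with
`M(ξ) = ξ_ρ A⁽ρ⁾ + ξ₁ A⁽¹⁾ + ξ₂ A⁽²⁾`, `s = ξ_ρ − N̂¹ξ₁ − N̂²ξ₂` and `ξ⃗ = (ξ₁, ξ₂)`,
`det M(ξ) = (det γ̂ / N̂⁴) s (2s² − N̂² ξ⃗ᵀγ̂⁻¹ξ⃗)`; hence `det M(ξ) = 0` iff the normal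
component `n̂·ξ = N̂⁻¹ s` vanishes or `ξ⃗ᵀγ̂⁻¹ξ⃗ − 2(n̂·ξ)² = 0`. -/
theorem momentum_constraint_characteristic
    (γ : Matrix (Fin 2) (Fin 2) ℝ) (hγ : γ.PosDef)
    (Nh : ℝ) (hNh : Nh ≠ 0) (N1 N2 : ℝ)
    (ξρ ξ1 ξ2 : ℝ)
    (M : Matrix (Fin 2 ⊕ Fin 1) (Fin 2 ⊕ Fin 1) ℝ)
    (hM : M = ξρ • momCoeffRho γ Nh + ξ1 • momCoeffK γ Nh ![N1, N2] 0
              + ξ2 • momCoeffK γ Nh ![N1, N2] 1)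
    (s : ℝ) (hs : s = ξρ - N1 * ξ1 - N2 * ξ2)
    (ξv : Fin 2 → ℝ) (hξv : ξv = ![ξ1, ξ2]) :
    M.det = (γ.det / Nh ^ 4) * s * (2 * s ^ 2 - Nh ^ 2 * (ξv ⬝ᵥ γ⁻¹.mulVec ξv)) ∧
    (M.det = 0 ↔
      Nh⁻¹ * s = 0 ∨ (ξv ⬝ᵥ γ⁻¹.mulVec ξv) - 2 * (Nh⁻¹ * s) ^ 2 = 0) := by
  have hd : γ.det ≠ 0 := hγ.det_pos.ne'
  have e01 : γ 1 0 = γ 0 1 := by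
    have h := hγ.isHermitian.apply 0 1
    simpa using h
  have hMb : M = Matrix.fromBlocks ((s / Nh ^ 2) • γ)
      (Matrix.of fun i (_ : Fin 1) => -(ξv i)) (Matrix.of fun (_ : Fin 1) j => -(ξv j))
      (Matrix.of fun _ _ => 2 * s) := by
    subst hM hs hξv
    have h2 : (2 : Matrix (Fin 1) (Fin 1) ℝ) 0 0 = 2 := by
      rw [← Matrix.diagonal_ofNat]
      rfl
    ext i j
    rcases i with i | i <;> rcases j with j | j <;> fin_cases i <;> fin_cases j <;>
      simp [momCoeffRho, momCoeffK, h2] <;> ring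
  have hq : ξv ⬝ᵥ γ⁻¹.mulVec ξv =
      (ξ1 ^ 2 * γ 1 1 - 2 * ξ1 * ξ2 * γ 0 1 + ξ2 ^ 2 * γ 0 0) / γ.det := by
    subst hξv
    rw [Matrix.inv_def, Matrix.adjugate_fin_two, Ring.inverse_eq_inv']
    simp [Matrix.mulVec, dotProduct, Fin.sum_univ_two, e01]
    ring
  have hdet : M.det = s / Nh ^ 2 * (2 * s ^ 2 * γ.det / Nh ^ 2
      - (ξ1 ^ 2 * γ 1 1 - 2 * ξ1 * ξ2 * γ 0 1 + ξ2 ^ 2 * γ 0 0)) := by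
    rw [← Matrix.det_submatrix_equiv_self (finSumFinEquiv (m := 2) (n := 1)).symm M,
      Matrix.det_fin_three]
    have h0 : (finSumFinEquiv (m := 2) (n := 1)).symm 0 = Sum.inl 0 := rfl
    have h1 : (finSumFinEquiv (m := 2) (n := 1)).symm 1 = Sum.inl 1 := rfl
    have h2 : (finSumFinEquiv (m := 2) (n := 1)).symm 2 = Sum.inr 0 := rfl
    simp only [Matrix.submatrix_apply]
    erw [h0, h1, h2]
    rw [hMb, hξv, Matrix.det_fin_two]
    simp [e01]
    ring
  have hmain : M.det = (γ.det / Nh ^ 4) * s *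
      (2 * s ^ 2 - Nh ^ 2 * (ξv ⬝ᵥ γ⁻¹.mulVec ξv)) := by
    rw [hdet, hq]
    field_simp
  refine ⟨hmain, ?_⟩
  generalize ξv ⬝ᵥ γ⁻¹.mulVec ξv = q at hmain
  have h3 : M.det = -(γ.det / Nh) * ((Nh⁻¹ * s) * (q - 2 * (Nh⁻¹ * s) ^ 2)) := by
    rw [hmain]
    field_simp
    ring
  have h4 : -(γ.det / Nh) ≠ 0 := neg_ne_zero.mpr (div_ne_zero hd hNh)
  rw [h3, mul_eq_zero, or_iff_right h4, mul_eq_zero]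
end

section
/- Let B : ℝ → Matrix (Fin 2) (Fin 2) ℝ be twice continuously differentiable on a neighborhood of t with B(s) invertible for all s there and satisfying the gauge condition Matrix.trace (B(s)⁻¹ * deriv B s) = 0 for all s in that neighborhood; let Ω : ℝ → ℝ be twice continuously differentiable at t with Ω(t) ≠ 0, and set A(s) = Ω(s)^2 • B(s). Then (1/2) * Matrix.trace (A(t)⁻¹ * deriv (deriv A) t) = deriv (deriv (fun s => Real.log (Ω s ^ 2))) t + (deriv (fun s => Real.log (Ω s ^ 2)) t)^2 + (1/2) * Matrix.trace ((B(t)⁻¹ * deriv B t) * (B(t)⁻¹ * deriv B t)). -/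
open Matrix

attribute [local instance] Matrix.normedAddCommGroup Matrix.normedSpace

theorem aux_c2 {E : Type*} [NormedAddCommGroup E] [NormedSpace ℝ E] (f : ℝ → E) (t : ℝ)
    (h : ContDiffAt ℝ 2 f t) : (∀ᶠ s in nhds t, HasDerivAt f (deriv f s) s) ∧
      HasDerivAt (deriv f) (deriv (deriv f) t) t := by
  constructor
  · filter_upwards [h.eventually (by simp)] with s hs
    exact (hs.differentiableAt (by norm_num)).hasDerivAt
  · have h1 : ContDiffAt ℝ 1 (fderiv ℝ f) t := h.fderiv_right (by norm_num)
    have h2 : DifferentiableAt ℝ (fderiv ℝ f) t := h1.differentiableAt (by norm_num)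
    have h3 : DifferentiableAt ℝ (deriv f) t := by
      have : deriv f = fun s => fderiv ℝ f s 1 := by
        ext s; simp
      rw [this]
      exact h2.clm_apply (differentiableAt_const _)
    exact h3.hasDerivAt

theorem aux_entry (B : ℝ → Matrix (Fin 2) (Fin 2) ℝ) (B' : Matrix (Fin 2) (Fin 2) ℝ) (t : ℝ)
    (h : HasDerivAt B B' t) (i j : Fin 2) : HasDerivAt (fun s => B s i j) (B' i j) t :=
  hasDerivAt_pi.1 (hasDerivAt_pi.1 h i) j

theorem aux_alg (B0 B1 B2 : Matrix (Fin 2) (Fin 2) ℝ) (f0 f1 f2 : ℝ) (hf0 : f0 ≠ 0)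
    (hd : B0.det ≠ 0)
    (hg0 : B0 1 1 * B1 0 0 + B0 0 0 * B1 1 1 - B0 0 1 * B1 1 0 - B0 1 0 * B1 0 1 = 0)
    (hg1 : B1 1 1 * B1 0 0 + B0 1 1 * B2 0 0 + (B1 0 0 * B1 1 1 + B0 0 0 * B2 1 1) -
      (B1 0 1 * B1 1 0 + B0 0 1 * B2 1 0) - (B1 1 0 * B1 0 1 + B0 1 0 * B2 0 1) = 0) :
    (1 / 2 : ℝ) * ((f0 • B0)⁻¹ * (f0 • B2 + f1 • B1 + (f1 • B1 + f2 • B0))).trace =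
      (f2 * f0 - f1 * f1) / f0 ^ 2 + (f1 / f0) ^ 2 +
      (1 / 2 : ℝ) * (B0⁻¹ * B1 * (B0⁻¹ * B1)).trace := by
  rw [Matrix.inv_def, Matrix.inv_def, Ring.inverse_eq_inv', Matrix.det_smul]
  simp only [Matrix.adjugate_fin_two, Matrix.trace_fin_two, Matrix.mul_apply, Fin.sum_univ_two,
    Matrix.smul_apply, Matrix.add_apply, smul_eq_mul, Matrix.of_apply, Matrix.cons_val', Matrix.cons_val_zero, Matrix.cons_val_one, Matrix.cons_val_fin_one, Fintype.card_fin]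
  have hdet : B0.det = B0 0 0 * B0 1 1 - B0 0 1 * B0 1 0 := Matrix.det_fin_two B0
  generalize B0.det = d at *
  generalize B0 0 0 = a at *
  generalize B0 0 1 = b at *
  generalize B0 1 0 = c at *
  generalize B0 1 1 = k at *
  generalize B1 0 0 = a1 at *
  generalize B1 0 1 = b1 at *
  generalize B1 1 0 = c1 at *
  generalize B1 1 1 = k1 at *
  generalize B2 0 0 = a2 at *
  generalize B2 0 1 = b2 at *
  generalize B2 1 0 = c2 at *
  generalize B2 1 1 = k2 at *
  field_simp
  subst hdet
  linear_combination f0 * ((a*k-b*c)*f0) * hg1 + f0 * (2*(a*k-b*c)*f1 - f0*(k * a1 + a * k1 - b * c1 - c * b1)) * hg0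

/-- Matrix form of `γ̂^{kl}(L_n K_{kl}) = L²_n(ln Ω²) + [L_n(ln Ω²)]²
+ (1/2) γ^{kp}γ^{lq}(L_nγ_{kl})(L_nγ_{pq})`: for a curve `B` of invertible `2×2`
matrices, `C²` on a neighborhood of `t` and satisfying the gauge condition
`tr(B⁻¹B') = 0` there, and a scalar `Ω`, twice continuously differentiable at `t` with
`Ω t ≠ 0`, the curve `A = Ω² • B` satisfies
`(1/2) tr(A⁻¹A'') = (ln Ω²)'' + ((ln Ω²)')² + (1/2) tr((B⁻¹B')(B⁻¹B'))`. -/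
theorem half_trace_second_deriv_conformal
    (B : ℝ → Matrix (Fin 2) (Fin 2) ℝ) (t : ℝ) (U : Set ℝ) (hU : U ∈ nhds t)
    (hB : ContDiffOn ℝ 2 B U) (hinv : ∀ s ∈ U, IsUnit (B s).det)
    (hgauge : ∀ s ∈ U, Matrix.trace ((B s)⁻¹ * deriv B s) = 0)
    (Ω : ℝ → ℝ) (hΩ : ContDiffAt ℝ 2 Ω t) (hΩ0 : Ω t ≠ 0)
    (A : ℝ → Matrix (Fin 2) (Fin 2) ℝ) (hA : ∀ s, A s = Ω s ^ 2 • B s) :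
    (1 / 2 : ℝ) * Matrix.trace ((A t)⁻¹ * deriv (deriv A) t) =
      deriv (deriv (fun s => Real.log (Ω s ^ 2))) t +
        (deriv (fun s => Real.log (Ω s ^ 2)) t) ^ 2 +
        (1 / 2 : ℝ) * Matrix.trace (((B t)⁻¹ * deriv B t) * ((B t)⁻¹ * deriv B t)) := by
  have hB1 : ∀ᶠ s in nhds t, HasDerivAt B (deriv B s) s := (aux_c2 B t (hB.contDiffAt hU)).1
  have hB2 : HasDerivAt (deriv B) (deriv (deriv B) t) t := (aux_c2 B t (hB.contDiffAt hU)).2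
  have hf : ContDiffAt ℝ 2 (fun s => Ω s ^ 2) t := hΩ.pow 2
  have hf0 : Ω t ^ 2 ≠ 0 := pow_ne_zero 2 hΩ0
  have hAe : A = fun s => Ω s ^ 2 • B s := funext hA
  subst hAe
  clear hA
  generalize hfd : (fun s => Ω s ^ 2) = f at hf
  have hfs : ∀ s, Ω s ^ 2 = f s := fun s => congrFun hfd s
  simp only [hfs] at hf0 ⊢
  obtain ⟨hf1, hf2⟩ := aux_c2 f t hf
  have hne : ∀ᶠ s in nhds t, f s ≠ 0 := hf.continuousAt.eventually_ne hf0
  have hBt := hB1.self_of_nhds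
  have hft := hf1.self_of_nhds
  -- logarithm
  have hl1 : deriv (fun s => Real.log (f s)) =ᶠ[nhds t] fun s => deriv f s / f s := by
    filter_upwards [hf1, hne] with s h1 h2
    exact (h1.log h2).deriv
  have hl2 : deriv (deriv (fun s => Real.log (f s))) t =
      (deriv (deriv f) t * f t - deriv f t * deriv f t) / f t ^ 2 := by
    rw [hl1.deriv_eq]
    exact (hf2.div hft hf0).deriv
  rw [hl2, hl1.self_of_nhds]
  -- second derivative of the product
  have hA1 : deriv (fun s => f s • B s) =ᶠ[nhds t] fun s => f s • deriv B s + deriv f s • B s := by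
    filter_upwards [hf1, hB1] with s h1 h2
    exact (h1.smul h2).deriv
  have hA2 : deriv (deriv (fun s => f s • B s)) t =
      (f t • deriv (deriv B) t + deriv f t • deriv B t) +
        (deriv f t • deriv B t + deriv (deriv f) t • B t) := by
    refine (Filter.EventuallyEq.deriv_eq hA1).trans ?_
    exact ((hft.smul hB2).add (hf2.smul hBt)).deriv
  rw [hA2]
  have hd : (B t).det ≠ 0 := (hinv t (mem_of_mem_nhds hU)).ne_zero
  -- gauge
  have hg : ∀ s ∈ U, B s 1 1 * deriv B s 0 0 + B s 0 0 * deriv B s 1 1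
      - B s 0 1 * deriv B s 1 0 - B s 1 0 * deriv B s 0 1 = 0 := by
    intro s hs
    have h := hgauge s hs
    have hds := (hinv s hs).ne_zero
    rw [Matrix.inv_def, Ring.inverse_eq_inv', Matrix.smul_mul, Matrix.trace_smul, smul_eq_mul] at h
    have h' := (mul_eq_zero.1 h).resolve_left (inv_ne_zero hds)
    simp only [Matrix.adjugate_fin_two, Matrix.trace_fin_two, Matrix.mul_apply, Fin.sum_univ_two, Matrix.of_apply, Matrix.cons_val', Matrix.cons_val_zero, Matrix.cons_val_one, Matrix.cons_val_fin_one] at h'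
    linarith
  have hg0 := hg t (mem_of_mem_nhds hU)
  have e := fun i j => aux_entry B _ t hBt i j
  have e2 := fun i j => aux_entry (deriv B) _ t hB2 i j
  have hG := ((((e 1 1).mul (e2 0 0)).add ((e 0 0).mul (e2 1 1))).sub
    ((e 0 1).mul (e2 1 0))).sub ((e 1 0).mul (e2 0 1))
  have hz : HasDerivAt (fun _ : ℝ => (0 : ℝ)) _ t := hG.congr_of_eventuallyEq (by
    filter_upwards [hU] with s hs
    exact (hg s hs).symm)
  have hg1 : deriv B t 1 1 * deriv B t 0 0 + B t 1 1 * deriv (deriv B) t 0 0 +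
      (deriv B t 0 0 * deriv B t 1 1 + B t 0 0 * deriv (deriv B) t 1 1) -
      (deriv B t 0 1 * deriv B t 1 0 + B t 0 1 * deriv (deriv B) t 1 0) -
      (deriv B t 1 0 * deriv B t 0 1 + B t 1 0 * deriv (deriv B) t 0 1) = 0 := hz.unique (hasDerivAt_const t (0 : ℝ))
  exact aux_alg _ _ _ _ _ _ hf0 hd hg0 hg1
end
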